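/- Under the hypotheses of the previous statement (finite affine IFS average contracting w.r.t. an ergodic shift-invariant measure m on Σ = Λ^ℤ), the coding map π satisfies the self-affinity relation S_{x_0}(π(σx)) = π(x) for m-almost every x, and the subexponential growth property lim_{n→∞} (1/n) log⁺‖π(σ^n x)‖ = 0 for m-almost every x. -/

import Mathlib

open MeasureTheory Set Filter ENNReal NNReal Topology

/-- The product `M_{x_0} ⋯ M_{x_{n-1}}` of the linear parts of an affine IFS along the
coding `x`. -/
noncomputable def matProd {Λ : Type*} {d : ℕ}
    (M : Λ → (EuclideanSpace ℝ (Fin d) →L[ℝ] EuclideanSpace ℝ (Fin d)))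
    (x : ℤ → Λ) (n : ℕ) : EuclideanSpace ℝ (Fin d) →L[ℝ] EuclideanSpace ℝ (Fin d) :=
  ((List.range n).map (fun i => M (x (i : ℤ)))).prod

/-- The running maximum `max (0, S₁ f, …, S_N f)` of the Birkhoff sums of `f`. -/
def birkhoffMax {α : Type*} (T : α → α) (f : α → ℝ) : ℕ → α → ℝ
  | 0, _ => 0
  | N + 1, x => max 0 (f x + birkhoffMax T f N (T x))

section BirkhoffMax

variable {α : Type*} {T : α → α} {f : α → ℝ}

lemma birkhoffMax_nonneg (N : ℕ) (x : α) : 0 ≤ birkhoffMax T f N x := by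
  cases N with
  | zero => exact le_rfl
  | succ N => exact le_max_left _ _

lemma birkhoffMax_mono (x : α) : Monotone fun N => birkhoffMax T f N x := by
  refine monotone_nat_of_le_succ fun N => ?_
  induction N generalizing x with
  | zero => exact birkhoffMax_nonneg _ _
  | succ N ih => exact max_le_max le_rfl (by gcongr; exact ih _)

lemma birkhoffSum_le_birkhoffMax (N : ℕ) (x : α) : birkhoffSum T f N x ≤ birkhoffMax T f N x := by
  induction N generalizing x with
  | zero => simp [birkhoffMax]
  | succ N ih =>
    rw [birkhoffSum_succ']
    exact (add_le_add le_rfl (ih _)).trans (le_max_right _ _)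

variable [MeasurableSpace α] {μ : Measure α}

lemma measurable_birkhoffMax (hT : Measurable T) (hf : Measurable f) (N : ℕ) :
    Measurable (birkhoffMax T f N) := by
  induction N with
  | zero => exact measurable_const
  | succ N ih => exact measurable_const.max (hf.add (ih.comp hT))

lemma integrable_birkhoffMax (hT : MeasurePreserving T μ μ) (hf : Integrable f μ) (N : ℕ) :
    Integrable (birkhoffMax T f N) μ := by
  induction N with
  | zero => exact integrable_zero _ _ _
  | succ N ih => exact (integrable_zero _ _ _).sup (hf.add (hT.integrable_comp_of_integrable ih))

/-- The maximal ergodic theorem. -/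
lemma setIntegral_birkhoffMax_pos_nonneg (hT : MeasurePreserving T μ μ) (hfm : Measurable f)
    (hf : Integrable f μ) (N : ℕ) : 0 ≤ ∫ x in {x | 0 < birkhoffMax T f N x}, f x ∂μ := by
  have hmeas : MeasurableSet {x | 0 < birkhoffMax T f N x} :=
    measurableSet_lt measurable_const (measurable_birkhoffMax hT.measurable hfm N)
  have hN := integrable_birkhoffMax hT hf N
  have hcomp : ∫ x, birkhoffMax T f N (T x) ∂μ = ∫ x, birkhoffMax T f N x ∂μ := by
    rw [← integral_map hT.measurable.aemeasurable (by rw [hT.map_eq]; exact hN.1), hT.map_eq]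
  have hle : ∀ x, birkhoffMax T f N x ≤
      {x | 0 < birkhoffMax T f N x}.indicator f x + birkhoffMax T f N (T x) := by
    intro x
    by_cases hx : 0 < birkhoffMax T f N x
    · rw [indicator_of_mem (by exact hx)]
      have h := birkhoffMax_mono (T := T) (f := f) x N.le_succ
      have h' : birkhoffMax T f (N + 1) x = max 0 (f x + birkhoffMax T f N (T x)) := rfl
      simp only [Nat.succ_eq_add_one] at h
      rw [h'] at h
      rcases le_max_iff.1 h with h | h
      · exact absurd hx h.not_gt
      · exact h
    · rw [indicator_of_notMem (by exact hx), zero_add]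
      exact (not_lt.1 hx).trans (birkhoffMax_nonneg _ _)
  have hint := integral_mono hN
    ((hf.indicator hmeas).add (hT.integrable_comp_of_integrable hN)) hle
  have hsplit := integral_add (hf.indicator hmeas) (hT.integrable_comp_of_integrable hN)
  simp only [Pi.add_apply, Function.comp_apply] at hint hsplit
  rw [hsplit, hcomp, integral_indicator hmeas] at hint
  linarith

lemma ae_exists_birkhoffMax_le (hT : Ergodic T μ) (hfm : Measurable f) (hf : Integrable f μ)
    (hneg : ∫ x, f x ∂μ < 0) : ∀ᵐ x ∂μ, ∃ C : ℕ, ∀ N, birkhoffMax T f N x ≤ C := by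
  set E : Set α := {x | ∃ C : ℕ, ∀ N, birkhoffMax T f N x ≤ C} with hE
  have hmeas : MeasurableSet E := by
    simp only [hE, ofPred_exists, ofPred_forall]
    exact .iUnion fun C => .iInter fun N =>
      measurableSet_le (measurable_birkhoffMax hT.measurable hfm N) measurable_const
  have hinv : T ⁻¹' E = E := by
    ext x
    constructor
    · rintro ⟨C, hC⟩
      obtain ⟨D, hD⟩ := exists_nat_ge (max 0 (f x + C))
      refine ⟨D, fun N => (birkhoffMax_mono x N.le_succ).trans (le_trans ?_ hD)⟩
      exact max_le_max le_rfl (by gcongr; exact hC N)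
    · rintro ⟨C, hC⟩
      obtain ⟨D, hD⟩ := exists_nat_ge (C - f x)
      refine ⟨D, fun N => ?_⟩
      have h := (le_max_right 0 (f x + birkhoffMax T f N (T x))).trans (hC (N + 1))
      linarith
  rcases hT.toPreErgodic.measure_self_or_compl_eq_zero hmeas hinv with h | h
  · exfalso
    have hlim := tendsto_setIntegral_of_monotone (f := f) (μ := μ)
      (s := fun N => {x | 0 < birkhoffMax T f N x})
      (fun N => measurableSet_lt measurable_const (measurable_birkhoffMax hT.measurable hfm N))
      (fun N K hNK x hx => lt_of_lt_of_le hx (birkhoffMax_mono x hNK)) hf.integrableOn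
    have huniv : (⋃ N, {x | 0 < birkhoffMax T f N x}) =ᵐ[μ] univ := by
      rw [eventuallyEq_univ]
      filter_upwards [measure_eq_zero_iff_ae_notMem.1 h] with x hx
      by_contra hcon
      refine hx ⟨0, fun N => ?_⟩
      rw [mem_iUnion, not_exists] at hcon
      simpa using hcon N
    rw [setIntegral_congr_set huniv, setIntegral_univ] at hlim
    exact hneg.not_ge (ge_of_tendsto' hlim fun N =>
      setIntegral_birkhoffMax_pos_nonneg hT.toMeasurePreserving hfm hf N)
  · exact h

/-- The upper half of Birkhoff's ergodic theorem. -/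
lemma ae_exists_birkhoffSum_le [IsProbabilityMeasure μ] (hT : Ergodic T μ) (hf : Integrable f μ)
    {c : ℝ} (hc : ∫ x, f x ∂μ < c) : ∀ᵐ x ∂μ, ∃ C : ℝ, ∀ n : ℕ, birkhoffSum T f n x ≤ n * c + C := by
  obtain ⟨g, hg, hfg⟩ := hf.1
  have hgi : Integrable g μ := hf.congr hfg
  have hneg : ∫ x, (g x - c) ∂μ < 0 := by
    rw [integral_sub hgi (integrable_const c), ← integral_congr_ae hfg]
    simpa using hc
  filter_upwards [ae_exists_birkhoffMax_le hT (hg.measurable.sub_const c)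
    (hgi.sub (integrable_const c)) hneg, ae_all_iff.2 fun n =>
    hT.toMeasurePreserving.quasiMeasurePreserving.birkhoffSum_ae_eq_of_ae_eq hfg n] with x hx hx'
  obtain ⟨C, hC⟩ := hx
  refine ⟨C, fun n => ?_⟩
  have h := (birkhoffSum_le_birkhoffMax n x).trans (hC n)
  rw [hx' n]
  simp only [birkhoffSum, Finset.sum_sub_distrib, Finset.sum_const, Finset.card_range,
    nsmul_eq_mul] at h ⊢
  linarith

/-- The lower half of Birkhoff's ergodic theorem. -/
lemma ae_exists_le_birkhoffSum [IsProbabilityMeasure μ] (hT : Ergodic T μ) (hf : Integrable f μ)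
    {c : ℝ} (hc : c < ∫ x, f x ∂μ) : ∀ᵐ x ∂μ, ∃ C : ℝ, ∀ n : ℕ, n * c - C ≤ birkhoffSum T f n x := by
  have hneg : ∫ x, (-f) x ∂μ < -c := by
    simp only [Pi.neg_apply, integral_neg]
    linarith
  filter_upwards [ae_exists_birkhoffSum_le hT hf.neg hneg] with x ⟨C, hC⟩
  refine ⟨C, fun n => ?_⟩
  have h := hC n
  simp only [birkhoffSum, Pi.neg_apply, Finset.sum_neg_distrib] at h ⊢
  linarith

end BirkhoffMax

section Submultiplicative

variable {α : Type*} {T : α → α} {v : ℕ → α → ℝ} {b : ℝ} {h : α → ℝ} {p : ℕ}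

lemma prod_submultiplicative_le (hp : 0 < p) (hv : ∀ n x, 0 ≤ v n x)
    (hsub : ∀ n k x, v (n + k) x ≤ v n x * v k (T^[n] x)) (hb : 0 ≤ b)
    (hvb : ∀ n x, v n x ≤ Real.exp (b * n)) (hvh : ∀ x, v p x ≤ Real.exp (h x)) (q : ℕ) (x : α) :
    ∏ r ∈ Finset.range p, v (q + p - r) (T^[r] x) ≤
      Real.exp (birkhoffSum T h q x + b * p * p) := by
  induction q generalizing x with
  | zero =>
    calc ∏ r ∈ Finset.range p, v (0 + p - r) (T^[r] x)
        ≤ ∏ r ∈ Finset.range p, Real.exp (b * p) := by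
          refine Finset.prod_le_prod (fun r _ => hv _ _) fun r _ => (hvb _ _).trans ?_
          gcongr
          omega
      _ = _ := by
          rw [Finset.prod_const, Finset.card_range, ← Real.exp_nat_mul]
          simp
          ring
  | succ q ih =>
    obtain ⟨p, rfl⟩ := Nat.exists_eq_add_one.2 hp
    have h1 : ∏ r ∈ Finset.range (p + 1), v (q + 1 + (p + 1) - r) (T^[r] x) =
        (∏ r ∈ Finset.range p, v (q + (p + 1) - r) (T^[r] (T x))) * v (q + 1 + (p + 1)) x := by
      rw [Finset.prod_range_succ']
      congr 1
      refine Finset.prod_congr rfl fun r _ => ?_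
      rw [Function.iterate_succ_apply]
      congr 1
      omega
    have h2 : ∏ r ∈ Finset.range (p + 1), v (q + (p + 1) - r) (T^[r] (T x)) =
        (∏ r ∈ Finset.range p, v (q + (p + 1) - r) (T^[r] (T x))) * v (q + 1) (T^[p + 1] x) := by
      rw [Finset.prod_range_succ, Function.iterate_succ_apply]
      congr 2
      omega
    have h3 : v (q + 1 + (p + 1)) x ≤ Real.exp (h x) * v (q + 1) (T^[p + 1] x) := by
      rw [add_comm (q + 1)]
      exact (hsub _ _ _).trans (mul_le_mul_of_nonneg_right (hvh x) (hv _ _))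
    calc _ ≤ (∏ r ∈ Finset.range p, v (q + (p + 1) - r) (T^[r] (T x))) *
          (Real.exp (h x) * v (q + 1) (T^[p + 1] x)) := by
          rw [h1]
          exact mul_le_mul_of_nonneg_left h3 (Finset.prod_nonneg fun _ _ => hv _ _)
      _ = Real.exp (h x) * ∏ r ∈ Finset.range (p + 1), v (q + (p + 1) - r) (T^[r] (T x)) := by
          rw [h2]; ring
      _ ≤ Real.exp (h x) * Real.exp (birkhoffSum T h q (T x) + b * ↑(p + 1) * ↑(p + 1)) := by
          gcongr
          exact ih _
      _ = _ := by
          rw [← Real.exp_add, birkhoffSum_succ', add_assoc]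

lemma submultiplicative_le_exp (hp : 0 < p) (hv : ∀ n x, 0 ≤ v n x)
    (hsub : ∀ n k x, v (n + k) x ≤ v n x * v k (T^[n] x)) (hb : 0 ≤ b)
    (hvb : ∀ n x, v n x ≤ Real.exp (b * n)) (hvh : ∀ x, v p x ≤ Real.exp (h x)) (q : ℕ) (x : α) :
    v (q + p) x ≤ Real.exp (birkhoffSum T h q x / p + 2 * b * p) := by
  have hp' : (0 : ℝ) < p := by exact_mod_cast hp
  refine le_of_pow_le_pow_left₀ hp.ne' (Real.exp_pos _).le ?_
  calc v (q + p) x ^ p = ∏ r ∈ Finset.range p, v (q + p) x := by simp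
    _ ≤ ∏ r ∈ Finset.range p, (Real.exp (b * p) * v (q + p - r) (T^[r] x)) := by
        refine Finset.prod_le_prod (fun _ _ => hv _ _) fun r hr => ?_
        have hr' := Finset.mem_range.1 hr
        have hs := hsub r (q + p - r) x
        rw [show r + (q + p - r) = q + p by omega] at hs
        refine hs.trans (mul_le_mul_of_nonneg_right ((hvb _ _).trans ?_) (hv _ _))
        gcongr
    _ = Real.exp (b * p * p) * ∏ r ∈ Finset.range p, v (q + p - r) (T^[r] x) := by
        rw [Finset.prod_mul_distrib, Finset.prod_const, Finset.card_range, ← Real.exp_nat_mul]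
        ring_nf
    _ ≤ Real.exp (b * p * p) * Real.exp (birkhoffSum T h q x + b * p * p) := by
        gcongr
        exact prod_submultiplicative_le hp hv hsub hb hvb hvh q x
    _ = _ := by
        rw [← Real.exp_add, ← Real.exp_nat_mul]
        congr 1
        field_simp
        ring

/-- If the Birkhoff sums of `h` stay close to `n * c` along the orbit of `x`, then `v k` at the
`n`-th point of the orbit decays exponentially in `k`, up to a small exponential error in `n`. -/
lemma submultiplicative_orbit_le (hp : 0 < p) (hv : ∀ n x, 0 ≤ v n x)
    (hsub : ∀ n k x, v (n + k) x ≤ v n x * v k (T^[n] x)) (hb : 0 ≤ b)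
    (hvb : ∀ n x, v n x ≤ Real.exp (b * n)) (hvh : ∀ x, v p x ≤ Real.exp (h x))
    {c δ C : ℝ} (hδ : 0 ≤ δ) (hcδ : 2 * δ ≤ -c) {x : α}
    (hup : ∀ n : ℕ, birkhoffSum T h n x ≤ n * (c + δ) + C)
    (hlow : ∀ n : ℕ, n * (c - δ) - C ≤ birkhoffSum T h n x) (n k : ℕ) :
    v k (T^[n] x) ≤
      Real.exp (2 * b * p + (2 * C + 2 * δ * n + c / 2 * (k - p)) / p) := by
  have hp' : (0 : ℝ) < p := by exact_mod_cast hp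
  have hC : 0 ≤ C := by simpa using hup 0
  rcases lt_or_ge k p with hk | hk
  · refine (hvb _ _).trans (Real.exp_le_exp.2 ?_)
    have hk' : (k : ℝ) ≤ p := by exact_mod_cast hk.le
    have h1 : b * k ≤ b * p := by gcongr
    have h2 : 0 ≤ b * p := by positivity
    have h3 : 0 ≤ (2 * C + 2 * δ * n + c / 2 * (k - p)) / p := by
      have : 0 ≤ c / 2 * (k - p) := mul_nonneg_of_nonpos_of_nonpos (by linarith) (by linarith)
      positivity
    linarith
  · obtain ⟨q, rfl⟩ := Nat.exists_eq_add_of_le' hk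
    refine (submultiplicative_le_exp hp hv hsub hb hvb hvh q _).trans (Real.exp_le_exp.2 ?_)
    have h1 := hup (n + q)
    have h2 := hlow n
    rw [birkhoffSum_add] at h1
    push_cast at h1 ⊢
    rw [add_comm]
    gcongr
    have h3 : (q : ℝ) * (2 * δ) ≤ q * -c := by gcongr
    nlinarith

end Submultiplicative

lemma tendsto_div_atTop_zero_of_forall_le {u : ℕ → ℝ} (hu : ∀ n, 0 ≤ u n)
    (h : ∀ j : ℕ, ∃ C : ℝ, ∀ n : ℕ, u n ≤ C + 1 / ((j : ℝ) + 1) * n) :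
    Tendsto (fun n : ℕ => u n / n) atTop (𝓝 0) := by
  rw [tendsto_order]
  refine ⟨fun a ha => .of_forall fun n => ha.trans_le (div_nonneg (hu n) n.cast_nonneg),
    fun ε hε => ?_⟩
  obtain ⟨j, hj⟩ := exists_nat_one_div_lt (half_pos hε)
  obtain ⟨C, hC⟩ := h j
  filter_upwards [(tendsto_const_div_atTop_nhds_zero_nat C).eventually (gt_mem_nhds (half_pos hε)),
    eventually_gt_atTop 0] with n hn hn0
  have hn' : (0 : ℝ) < n := by exact_mod_cast hn0
  calc u n / n ≤ (C + 1 / ((j : ℝ) + 1) * n) / n := by gcongr; exact hC n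
    _ = C / n + 1 / ((j : ℝ) + 1) := by field_simp
    _ < ε := by linarith

section MatProd

variable {Λ : Type*} {d : ℕ}
  (M : Λ → (EuclideanSpace ℝ (Fin d) →L[ℝ] EuclideanSpace ℝ (Fin d)))

lemma shift_iterate_apply (n : ℕ) (x : ℤ → Λ) (i : ℤ) :
    (fun (y : ℤ → Λ) (j : ℤ) => y (j + 1))^[n] x i = x (i + n) := by
  induction n generalizing x with
  | zero => simp
  | succ n ih =>
    rw [Function.iterate_succ_apply, ih]
    push_cast
    congr 1
    ring

lemma matProd_eq_prod_map (x : ℤ → Λ) (n : ℕ) :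
    matProd M x n = ((List.range n).map fun i : ℕ => M (x i)).prod := by
  simp [matProd, ← List.map_eq_flatMap, Function.comp_def]

lemma matProd_zero (x : ℤ → Λ) : matProd M x 0 = 1 := by simp [matProd]

lemma matProd_one (x : ℤ → Λ) : matProd M x 1 = M (x 0) := by simp [matProd]

lemma matProd_add (x : ℤ → Λ) (n k : ℕ) :
    matProd M x (n + k) =
      matProd M x n * matProd M ((fun (y : ℤ → Λ) (j : ℤ) => y (j + 1))^[n] x) k := by
  simp only [matProd_eq_prod_map, List.range_add, List.map_append, List.prod_append, List.map_map]
  congr 3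
  funext i
  simp only [Function.comp_apply, shift_iterate_apply]
  push_cast
  rw [add_comm]

lemma exists_norm_matProd_le_exp [Finite Λ] :
    ∃ b : ℝ, 0 ≤ b ∧ ∀ (n : ℕ) (x : ℤ → Λ), ‖matProd M x n‖ ≤ Real.exp (b * n) := by
  obtain ⟨B, hB⟩ := (finite_range fun i => ‖M i‖).bddAbove
  refine ⟨max 0 B, le_max_left _ _, fun n x => ?_⟩
  induction n generalizing x with
  | zero =>
    rw [matProd_zero]
    simpa using! ContinuousLinearMap.norm_id_le
  | succ n ih =>
    rw [add_comm, matProd_add, matProd_one]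
    have h1 : ‖M (x 0)‖ ≤ Real.exp (max 0 B) := by
      have h2 := hB (mem_range_self (x 0))
      have h3 := Real.add_one_le_exp (max 0 B)
      have h4 := le_max_right 0 B
      linarith
    calc _ ≤ ‖M (x 0)‖ * _ := norm_mul_le _ _
      _ ≤ Real.exp (max 0 B) * Real.exp (max 0 B * n) := by
          gcongr
          exact ih _
      _ = _ := by
          rw [← Real.exp_add]
          push_cast
          ring_nf

lemma exists_integral_log_norm_matProd_neg [MeasurableSpace Λ] {m : Measure (ℤ → Λ)} {lam : EReal}
    (hneg : lam < 0)
    (hlam : Tendsto (fun n : ℕ => (((∫ x, Real.log ‖matProd M x n‖ ∂m) / n : ℝ) : EReal))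
      atTop (𝓝 lam)) :
    ∃ p : ℕ, 0 < p ∧ ∫ x, Real.log ‖matProd M x p‖ ∂m < 0 := by
  obtain ⟨p, hp, hp0⟩ :=
    ((hlam.eventually (gt_mem_nhds hneg)).and (eventually_gt_atTop 0)).exists
  refine ⟨p, hp0, ?_⟩
  have hp' : (0 : ℝ) < p := by exact_mod_cast hp0
  have h : (∫ x, Real.log ‖matProd M x p‖ ∂m) / p < 0 := by exact_mod_cast hp
  exact (div_neg_iff.1 h).resolve_left (fun h => h.2.not_gt hp') |>.1

variable {M}

/-- If `‖M_{y_0} ⋯ M_{y_{k-1}}‖ ≤ K r ^ k` with `r < 1`, the coded point of `y` has norm at most a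
constant multiple of `K`. -/
lemma norm_le_of_tendsto_sum_matProd {a : Λ → EuclideanSpace ℝ (Fin d)} {y : ℤ → Λ}
    {z : EuclideanSpace ℝ (Fin d)}
    (hz : Tendsto (fun n : ℕ => ∑ k ∈ Finset.range (n + 1), matProd M y k (a (y (k : ℤ))))
        atTop (𝓝 z))
    {A K r : ℝ} (ha : ∀ i, ‖a i‖ ≤ A) (hr0 : 0 ≤ r) (hr1 : r < 1)
    (hy : ∀ k, ‖matProd M y k‖ ≤ K * r ^ k) : ‖z‖ ≤ A * K * (1 - r)⁻¹ := by
  have hA : 0 ≤ A := (norm_nonneg _).trans (ha (y 0))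
  have hK : 0 ≤ K := by simpa using (norm_nonneg _).trans (hy 0)
  refine le_of_tendsto' hz.norm fun n => ?_
  calc _ ≤ ∑ k ∈ Finset.range (n + 1), A * K * r ^ k := by
        refine norm_sum_le_of_le _ fun k _ => ?_
        calc _ ≤ ‖matProd M y k‖ * ‖a (y k)‖ := ContinuousLinearMap.le_opNorm _ _
          _ ≤ (K * r ^ k) * A := by
            gcongr
            · exact hy k
            · exact ha _
          _ = _ := by ring
    _ = A * K * ∑ k ∈ Finset.range (n + 1), r ^ k := by rw [Finset.mul_sum]
    _ ≤ _ := by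
        gcongr
        rw [← tsum_geometric_of_lt_one hr0 hr1]
        exact (summable_geometric_of_lt_one hr0 hr1).sum_le_tsum _ fun _ _ => by positivity

end MatProd

/-- For an average contracting affine IFS and ergodic shift-invariant `m`, the coding map
satisfies `S_{x_0}(π(σx)) = π(x)` a.e., and `(1/n) log⁺‖π(σ^n x)‖ → 0` a.e. -/
theorem stmt6 {Λ : Type*} [Fintype Λ] [MeasurableSpace Λ] {d : ℕ}
    (M : Λ → (EuclideanSpace ℝ (Fin d) →L[ℝ] EuclideanSpace ℝ (Fin d)))
    (a : Λ → EuclideanSpace ℝ (Fin d))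
    (m : Measure (ℤ → Λ)) [IsProbabilityMeasure m]
    (σ : (ℤ → Λ) → (ℤ → Λ)) (hσ : σ = fun x (n : ℤ) => x (n + 1))
    (herg : Ergodic σ m)
    (lam : EReal) (hlam_neg : lam < 0)
    (hlam : Tendsto
      (fun n : ℕ => (((∫ x, Real.log ‖matProd M x n‖ ∂m) / n : ℝ) : EReal))
      atTop (𝓝 lam))
    (π : (ℤ → Λ) → EuclideanSpace ℝ (Fin d))
    (hπ : ∀ᵐ x ∂m,
      Tendsto (fun n : ℕ => ∑ k ∈ Finset.range (n + 1), matProd M x k (a (x (k : ℤ))))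
        atTop (𝓝 (π x))) :
    (∀ᵐ x ∂m, M (x 0) (π (σ x)) + a (x 0) = π x) ∧
    (∀ᵐ x ∂m,
      Tendsto (fun n : ℕ => (max 0 (Real.log ‖π (σ^[n] x)‖)) / n) atTop (𝓝 0)) := by
  subst hσ
  set σ : (ℤ → Λ) → (ℤ → Λ) := fun x n => x (n + 1) with hσ
  have hmp := herg.toMeasurePreserving
  refine ⟨?_, ?_⟩
  · filter_upwards [hπ, hmp.quasiMeasurePreserving.ae hπ] with x hx hσx
    refine tendsto_nhds_unique ?_ ((tendsto_add_atTop_iff_nat 1).2 hx)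
    refine (((M (x 0)).continuous.tendsto _).comp hσx |>.add_const (a (x 0))).congr fun n => ?_
    rw [Finset.sum_range_succ', Function.comp_apply, map_sum, matProd_zero]
    congr 1
    refine Finset.sum_congr rfl fun k _ => ?_
    rw [add_comm k 1, matProd_add, matProd_one]
    simp [σ, add_comm]
  obtain ⟨p, hp, hneg⟩ := exists_integral_log_norm_matProd_neg M hlam_neg hlam
  obtain ⟨b, hb, hvb⟩ := exists_norm_matProd_le_exp M
  obtain ⟨A, hA⟩ := (finite_range fun i => ‖a i‖).bddAbove
  have ha : ∀ i, ‖a i‖ ≤ A := fun i => hA (mem_range_self i)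
  set h : (ℤ → Λ) → ℝ := fun x => Real.log ‖matProd M x p‖ with hh
  set c : ℝ := ∫ x, h x ∂m with hc
  have hint : Integrable h m := not_not.1 fun hcon => hneg.ne (integral_undef hcon)
  have hvh : ∀ x, ‖matProd M x p‖ ≤ Real.exp (h x) := fun x => Real.le_exp_log _
  have hp' : (0 : ℝ) < p := by exact_mod_cast hp
  have hp1 : (1 : ℝ) ≤ p := by exact_mod_cast hp
  have hδ : ∀ j : ℕ, ∃ δ : ℝ, 0 < δ ∧ 2 * δ ≤ -c ∧ 2 * δ ≤ 1 / ((j : ℝ) + 1) := fun j =>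
    ⟨min (-c) (1 / ((j : ℝ) + 1)) / 2, half_pos (lt_min (neg_pos.2 hneg) (by positivity)),
      by linarith [min_le_left (-c) (1 / ((j : ℝ) + 1))],
      by linarith [min_le_right (-c) (1 / ((j : ℝ) + 1))]⟩
  choose δ hδ0 hδc hδj using hδ
  filter_upwards [ae_all_iff.2 fun n => (hmp.iterate n).quasiMeasurePreserving.ae hπ,
    ae_all_iff.2 fun j => ae_exists_birkhoffSum_le herg hint (lt_add_of_pos_right c (hδ0 j)),
    ae_all_iff.2 fun j => ae_exists_le_birkhoffSum herg hint (sub_lt_self c (hδ0 j))]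
    with x hx hup hlow
  refine tendsto_div_atTop_zero_of_forall_le (fun n => le_max_left _ _) fun j => ?_
  obtain ⟨C₁, hC₁⟩ := hup j
  obtain ⟨C₂, hC₂⟩ := hlow j
  have hbound := submultiplicative_orbit_le (T := σ) (v := fun n x => ‖matProd M x n‖) hp
    (fun _ _ => norm_nonneg _)
    (fun n k x => (congrArg norm (matProd_add M x n k)).trans_le (norm_mul_le _ _))
    hb hvb hvh (hδ0 j).le (hδc j) (C := max C₁ C₂)
    (fun n => (hC₁ n).trans (by gcongr; exact le_max_left _ _))
    (fun n => le_trans (by gcongr; exact le_max_right _ _) (hC₂ n))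
  set r : ℝ := Real.exp (c / 2 / p) with hr
  have hr1 : r < 1 := Real.exp_lt_one_iff.2 (div_neg_of_neg_of_pos (by linarith) hp')
  set D : ℝ := 2 * b * p + (2 * max C₁ C₂ - c / 2 * p) / p with hD
  set K : ℝ := max 1 (A * Real.exp D * (1 - r)⁻¹) with hK
  have hK1 : 1 ≤ K := le_max_left _ _
  refine ⟨Real.log K, fun n => ?_⟩
  have hnorm : ‖π (σ^[n] x)‖ ≤ K * Real.exp (2 * δ j * n / p) := by
    refine (norm_le_of_tendsto_sum_matProd (hx n) ha (Real.exp_pos _).le hr1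
      (K := Real.exp D * Real.exp (2 * δ j * n / p)) fun k => (hbound n k).trans_eq ?_).trans ?_
    · rw [← Real.exp_nat_mul, ← Real.exp_add, ← Real.exp_add]
      congr 1
      rw [hD]
      field_simp
      ring
    · calc _ = A * Real.exp D * (1 - r)⁻¹ * Real.exp (2 * δ j * n / p) := by ring
        _ ≤ _ := by
          gcongr
          exact le_max_right _ _
  have hexp : 2 * δ j * n / p ≤ 1 / ((j : ℝ) + 1) * n := by
    refine (div_le_self ?_ hp1).trans ?_
    · have := hδ0 j
      positivity
    · gcongr
      exact hδj j
  refine max_le (add_nonneg (Real.log_nonneg hK1) (by positivity)) ?_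
  rcases (norm_nonneg (π (σ^[n] x))).eq_or_lt with h0 | h0
  · rw [← h0, Real.log_zero]
    exact add_nonneg (Real.log_nonneg hK1) (by positivity)
  · refine (Real.log_le_log h0 hnorm).trans ?_
    rw [Real.log_mul (by positivity) (Real.exp_pos _).ne', Real.log_exp]
    gcongr
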